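/- For a weakly C(4) finite monoid presentation ⟨A | R⟩: suppose a word u has a (not necessarily clean) overlap prefix wXY. If u ≡ v, then w is a prefix of v and no relation word occurring as a factor of v overlaps the prefix w. -/

import Mathlib

open List

/-- A *relation word* is a word occurring as one side of some relation in `R`. -/
def RelWord {A : Type*} (R : Finset (List A × List A)) (w : List A) : Prop :=
  ∃ p ∈ R, w = p.1 ∨ w = p.2

/-- One elementary rewriting step using a defining relation (in either direction). -/
def OneStep {A : Type*} (R : Finset (List A × List A)) (u v : List A) : Prop :=
  ∃ l r x y, ((x, y) ∈ R ∨ (y, x) ∈ R) ∧ u = l ++ x ++ r ∧ v = l ++ y ++ r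

/-- `u ≡ v`: the congruence on the free monoid `A*` generated by the relations `R`. -/
def MEquiv {A : Type*} (R : Finset (List A × List A)) : List A → List A → Prop :=
  Relation.ReflTransGen (OneStep R)

/-- A *piece*: a word occurring as a factor of two distinct relation words, or in two
different (possibly overlapping) positions within one relation word.  The empty word
is a piece. -/
def Piece {A : Type*} (R : Finset (List A × List A)) (p : List A) : Prop :=
  p = [] ∨ ∃ r₁ r₂ a₁ b₁ a₂ b₂, RelWord R r₁ ∧ RelWord R r₂ ∧
    r₁ = a₁ ++ p ++ b₁ ∧ r₂ = a₂ ++ p ++ b₂ ∧ (r₁ ≠ r₂ ∨ a₁ ≠ a₂)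

/-- Weakly `C(n)`: no relation word is a product of strictly fewer than `n` pieces. -/
def WeaklyC {A : Type*} (R : Finset (List A × List A)) (n : ℕ) : Prop :=
  ∀ w, RelWord R w → ∀ L : List (List A), (∀ p ∈ L, Piece R p) → w = L.flatten →
    n ≤ L.length

/-- `X` is the maximal (longest) prefix of `r` which is a piece. -/
def MaxPiecePrefix {A : Type*} (R : Finset (List A × List A)) (r X : List A) : Prop :=
  X <+: r ∧ Piece R X ∧ ∀ p, p <+: r → Piece R p → p.length ≤ X.length

/-- `Z` is the maximal (longest) suffix of `r` which is a piece. -/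
def MaxPieceSuffix {A : Type*} (R : Finset (List A × List A)) (r Z : List A) : Prop :=
  Z <:+ r ∧ Piece R Z ∧ ∀ s, s <:+ r → Piece R s → s.length ≤ Z.length

/-- `X ++ Y ++ Z` is a relation word with maximal piece prefix `X`, middle word `Y`
and maximal piece suffix `Z`. -/
def RelDecomp {A : Type*} (R : Finset (List A × List A)) (X Y Z : List A) : Prop :=
  RelWord R (X ++ Y ++ Z) ∧ MaxPiecePrefix R (X ++ Y ++ Z) X ∧
    MaxPieceSuffix R (X ++ Y ++ Z) Z

/-- `q` is a relation prefix of `u`: a prefix of the form `a ++ X ++ Y` where `X`, `Y`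
are the maximal piece prefix and middle word of some relation word `X ++ Y ++ Z`. -/
def RelPrefix {A : Type*} (R : Finset (List A × List A)) (u q : List A) : Prop :=
  q <+: u ∧ ∃ a X Y Z, q = a ++ X ++ Y ∧ RelDecomp R X Y Z

/-- `a ++ X ++ Y` is an overlap prefix of `u`, with final maximal piece prefix `X` and
middle word `Y`, i.e. it admits a factorisation `b X₁ Y₁' ⋯ X_{n-1} Y_{n-1}' X_n Y_n`
with `X = X_n`, `Y = Y_n`, no factor `X₀ Y₀` beginning strictly before the end of `b`,
each `X_i Y_i Z_i` a relation word factored into maximal piece prefix, middle word and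
maximal piece suffix, and each `Y_i'` (`i < n`) a proper non-empty prefix of `Y_i`. -/
def OPrefix {A : Type*} (R : Finset (List A × List A)) (u a X Y : List A) : Prop :=
  (a ++ X ++ Y) <+: u ∧
  ∃ (b : List A) (n : ℕ) (Xs Ys Zs Ys' : ℕ → List A),
    1 ≤ n ∧ Xs (n - 1) = X ∧ Ys (n - 1) = Y ∧
    a = b ++ ((List.range (n - 1)).map fun i => Xs i ++ Ys' i).flatten ∧
    (∀ i < n, RelDecomp R (Xs i) (Ys i) (Zs i)) ∧
    (∀ i < n - 1, Ys' i ≠ [] ∧ Ys' i <+: Ys i ∧ Ys' i ≠ Ys i) ∧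
    ¬ ∃ c d X₀ Y₀ Z₀, RelDecomp R X₀ Y₀ Z₀ ∧
        a ++ X ++ Y = c ++ X₀ ++ Y₀ ++ d ∧ c.length < b.length

/-- The relation prefix `a ++ X ++ Y` of `u` is *clean*: `u` has no prefix
`a ++ X ++ Y₀ ++ X₁ ++ Y₁` with `Y₀` a proper non-empty prefix of `Y` and `X₁`, `Y₁`
the maximal piece prefix and middle word of some relation word. -/
def CleanAt {A : Type*} (R : Finset (List A × List A)) (u a X Y : List A) : Prop :=
  ¬ ∃ Y₀ X₁ Y₁ Z₁, RelDecomp R X₁ Y₁ Z₁ ∧ Y₀ ≠ [] ∧ Y₀ <+: Y ∧ Y₀ ≠ Y ∧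
      (a ++ X ++ Y₀ ++ X₁ ++ Y₁) <+: u

/-- `a ++ X ++ Y` is a clean overlap prefix of `u`, where `X ++ Y ++ Z` is a relation
word with maximal piece prefix `X`, middle word `Y` and maximal piece suffix `Z`. -/
def CleanOverlapPrefix {A : Type*} (R : Finset (List A × List A))
    (u a X Y Z : List A) : Prop :=
  RelDecomp R X Y Z ∧ OPrefix R u a X Y ∧ CleanAt R u a X Y

/-- `r'` is a complement of the relation word `r`: there is a chain of relation words
from `r` to `r'` each consecutive pair of which forms a relation (in some order). -/
def RelComplement {A : Type*} (R : Finset (List A × List A)) (r r' : List A) : Prop :=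
  RelWord R r ∧ Relation.ReflTransGen (fun s t => (s, t) ∈ R ∨ (t, s) ∈ R) r r'

/-- `u` is `p`-active: `p ++ u` has a relation prefix `a ++ X ++ Y` with `|a| < |p|`. -/
def PActive {A : Type*} (R : Finset (List A × List A)) (p u : List A) : Prop :=
  ∃ a X Y Z, RelDecomp R X Y Z ∧ (a ++ X ++ Y) <+: (p ++ u) ∧ a.length < p.length

/-- `p` is a possible prefix of `u`: `p ++ w ≡ u` for some word `w`. -/
def PossPrefix {A : Type*} (R : Finset (List A × List A)) (p u : List A) : Prop :=
  ∃ w, MEquiv R (p ++ w) u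

section SmallOverlap

variable {A : Type*} {R : Finset (List A × List A)}

theorem Piece.of_factor {p a b : List A} (h : Piece R (a ++ p ++ b)) : Piece R p := by
  rcases h with h | ⟨r₁, r₂, a₁, b₁, a₂, b₂, h₁, h₂, e₁, e₂, h⟩
  · exact Or.inl (by simp_all)
  · refine Or.inr ⟨r₁, r₂, a₁ ++ a, b ++ b₁, a₂ ++ a, b ++ b₂, h₁, h₂, by simp [e₁],
      by simp [e₂], h.imp id fun h h' => h (List.append_cancel_right h')⟩

theorem Piece.of_occurrences {r₁ r₂ p a₁ b₁ a₂ b₂ : List A} (h₁ : RelWord R r₁)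
    (h₂ : RelWord R r₂) (e₁ : r₁ = a₁ ++ p ++ b₁) (e₂ : r₂ = a₂ ++ p ++ b₂)
    (h : r₁ ≠ r₂ ∨ a₁ ≠ a₂) : Piece R p :=
  Or.inr ⟨r₁, r₂, a₁, b₁, a₂, b₂, h₁, h₂, e₁, e₂, h⟩

theorem WeaklyC.not_piece_relWord (hC : WeaklyC R 4) {r : List A} (hr : RelWord R r) :
    ¬ Piece R r := fun h => by
  simpa using hC r hr [r] (by simpa using h) (by simp)

theorem WeaklyC.not_piece_middle (hC : WeaklyC R 4) {X Y Z : List A}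
    (h : RelDecomp R X Y Z) : ¬ Piece R Y := fun hY => by
  simpa using hC _ h.1 [X, Y, Z] (by simp [hY, h.2.1.2.1, h.2.2.2.1]) (by simp)

theorem RelDecomp.not_piece_append {X Y Z y : List A} (h : RelDecomp R X Y Z)
    (hy : y ≠ []) (hp : y <+: Y) : ¬ Piece R (X ++ y) := fun hP => by
  obtain ⟨z, rfl⟩ := hp
  have hle := h.2.1.2.2 (X ++ y) ⟨z ++ Z, by simp⟩ hP
  have := List.length_pos_iff.2 hy
  rw [List.length_append] at hle
  omega

theorem WeaklyC.middle_ne_nil (hC : WeaklyC R 4) {X Y Z : List A}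
    (h : RelDecomp R X Y Z) : Y ≠ [] := fun hY =>
  hC.not_piece_middle h (Or.inl hY)

theorem WeaklyC.not_piece_prefix_middle (hC : WeaklyC R 4) {X Y Z : List A}
    (h : RelDecomp R X Y Z) : ¬ Piece R (X ++ Y) :=
  h.not_piece_append (hC.middle_ne_nil h) List.prefix_rfl

theorem RelDecomp.eq_prefix_middle {X Y Z X' Y' Z' : List A} (h : RelDecomp R X Y Z)
    (h' : RelDecomp R X' Y' Z') (e : X ++ Y ++ Z = X' ++ Y' ++ Z') :
    X ++ Y = X' ++ Y' := by
  have h₁ := h.2.2.2.2 Z' (e ▸ ⟨X' ++ Y', rfl⟩) h'.2.2.2.1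
  have h₂ := h'.2.2.2.2 Z (e ▸ ⟨X ++ Y, rfl⟩) h.2.2.2.1
  exact (List.append_inj' e (le_antisymm h₂ h₁)).1

theorem WeaklyC.exists_relDecomp (hC : WeaklyC R 4) {r : List A} (hr : RelWord R r) :
    ∃ X Y Z, r = X ++ Y ++ Z ∧ RelDecomp R X Y Z := by
  classical
  have hnil : Piece R ([] : List A) := Or.inl rfl
  set n := Nat.findGreatest (fun k => Piece R (r.take k)) r.length
  have hnP : Piece R (r.take n) :=
    Nat.findGreatest_spec (P := fun k => Piece R (r.take k)) (Nat.zero_le _)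
      (by simpa using hnil)
  have hex : ∃ k, Piece R (r.drop k) := ⟨r.length, by simpa using hnil⟩
  set m := Nat.find hex
  have hmP : Piece R (r.drop m) := Nat.find_spec hex
  have hlt : n < m := by
    by_contra! hle
    have hd : Piece R (r.drop n) := by
      refine Piece.of_factor (a := (r.drop m).take (n - m)) (b := []) ?_
      convert hmP using 1
      rw [List.append_nil]
      conv_rhs => rw [← List.take_append_drop (n - m) (r.drop m)]
      rw [List.drop_drop]
      congr 2
      omega
    simpa using hC r hr [r.take n, r.drop n] (by simp [hnP, hd]) (by simp)
  have hnr : n ≤ r.length := Nat.findGreatest_le _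
  have hmr : m ≤ r.length := Nat.find_min' hex (by simpa using hnil)
  have e : r = r.take n ++ (r.drop n).take (m - n) ++ r.drop m := by
    have : r.drop m = (r.drop n).drop (m - n) := by
      rw [List.drop_drop]; congr 1; omega
    rw [this, List.append_assoc, List.take_append_drop, List.take_append_drop]
  refine ⟨_, _, _, e, e ▸ hr, ?_, ?_⟩ <;> rw [← e]
  · refine ⟨List.take_prefix _ _, hnP, fun p hp hP => ?_⟩
    rw [List.length_take, min_eq_left hnr]
    refine Nat.le_findGreatest hp.length_le ?_
    rwa [← List.prefix_iff_eq_take.1 hp]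
  · refine ⟨List.drop_suffix _ _, hmP, fun p hp hP => ?_⟩
    have := Nat.find_min' hex (m := r.length - p.length)
      (by rwa [← List.suffix_iff_eq_drop.1 hp])
    have := hp.length_le
    rw [List.length_drop]
    omega

/-- A word with no factor that is a relation word and no suffix of the form `X₀ ++ Y₀ ++ p` with
`p` a prefix of the maximal piece suffix `Z₀` of a relation word `X₀ ++ Y₀ ++ Z₀`. -/
def Inert (R : Finset (List A × List A)) (w : List A) : Prop :=
  (∀ c r d, RelWord R r → w ≠ c ++ r ++ d) ∧
    ∀ c X₀ Y₀ Z₀ p, RelDecomp R X₀ Y₀ Z₀ → p <+: Z₀ → w ≠ c ++ X₀ ++ Y₀ ++ p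

theorem Inert.length_le (hC : WeaklyC R 4) {w X Y Z y s c r d : List A} (hw : Inert R w)
    (hD : RelDecomp R X Y Z) (hy : y ≠ []) (hp : y <+: Y) (hr : RelWord R r)
    (e : w ++ X ++ y ++ s = c ++ r ++ d) : w.length ≤ c.length := by
  by_contra! hlt
  obtain ⟨q, hq⟩ : ∃ q, w = c ++ q := by
    have h₁ : c <+: w ++ X ++ y ++ s := e ▸ ⟨r ++ d, by simp⟩
    have h₂ : w <+: w ++ X ++ y ++ s := ⟨X ++ y ++ s, by simp⟩
    obtain ⟨q, h⟩ := List.prefix_of_prefix_length_le h₁ h₂ hlt.le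
    exact ⟨q, h.symm⟩
  have hq0 : q ≠ [] := by rintro rfl; simp [hq] at hlt
  subst hq
  have e' : q ++ (X ++ y ++ s) = r ++ d := by simpa using e
  rcases List.append_eq_append_iff.1 e' with ⟨t, rfl, ht⟩ | ⟨t, rfl, -⟩
  · obtain ⟨X₀, Y₀, Z₀, hr₀, hD₀⟩ := hC.exists_relDecomp hr
    have hXy : ¬ (X ++ y) <+: t := by
      rintro ⟨t', rfl⟩
      obtain ⟨z, rfl⟩ := hp
      exact hD.not_piece_append hy ⟨z, rfl⟩ (Piece.of_occurrences (a₁ := q) (b₁ := t')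
        (a₂ := []) (b₂ := z ++ Z) hr hD.1 (by simp) (by simp) (Or.inr hq0))
    have htXy : t <+: X ++ y :=
      (List.prefix_or_prefix_of_prefix (l₃ := X ++ y ++ s) ⟨s, rfl⟩
        ⟨d, ht.symm⟩).resolve_left hXy
    obtain ⟨t', ht'⟩ := htXy
    obtain ⟨z, rfl⟩ := hp
    have hP : Piece R t := Piece.of_occurrences (a₁ := q) (b₁ := [])
      (a₂ := []) (b₂ := t' ++ z ++ Z) hr hD.1 (by simp)
        (by simp only [List.nil_append, ← List.append_assoc, ht']) (Or.inr hq0)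
    have hle := hD₀.2.2.2.2 t (hr₀ ▸ ⟨q, rfl⟩) hP
    have hsuf : t <:+ Z₀ := List.suffix_of_suffix_length_le (l₃ := q ++ t) ⟨q, rfl⟩
      ⟨X₀ ++ Y₀, hr₀.symm⟩ hle
    obtain ⟨p, rfl⟩ := hsuf
    have : q = X₀ ++ Y₀ ++ p := by
      apply List.append_cancel_right (bs := t); simpa using hr₀
    exact hw.2 c X₀ Y₀ (p ++ t) p hD₀ ⟨t, rfl⟩ (by simp [this])
  · exact hw.1 c r t hr (by simp)

theorem Inert.append (hC : WeaklyC R 4) {w X Y Z y : List A} (hw : Inert R w)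
    (hD : RelDecomp R X Y Z) (hy : y ≠ []) (hp : y <+: Y) (hne : y ≠ Y) :
    Inert R (w ++ X ++ y) := by
  have hlt : y.length < Y.length :=
    lt_of_le_of_ne hp.length_le fun h => hne (hp.eq_of_length h)
  obtain ⟨z, hz⟩ := hp
  refine ⟨fun c r d hr e => ?_, fun c X₀ Y₀ Z₀ p hD₀ ⟨p', hp'⟩ e => ?_⟩
  · have hle := hw.length_le hC (s := []) hD hy ⟨z, hz⟩ hr (by simpa using e)
    obtain ⟨q, rfl⟩ : w <+: c := List.prefix_of_prefix_length_le (l₃ := w ++ X ++ y)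
      ⟨X ++ y, by simp⟩ (e ▸ ⟨r ++ d, by simp⟩) hle
    have e' : X ++ y = q ++ r ++ d := by simpa using e
    have hlen := congrArg List.length e'
    refine hC.not_piece_relWord hr (Piece.of_occurrences (a₁ := []) (b₁ := []) (a₂ := q)
      (b₂ := d ++ z ++ Z) hr hD.1 (by simp)
      (by rw [← hz, ← List.append_assoc X, e']; simp) (Or.inl fun h => ?_))
    subst h
    simp at hlen
    omega
  · rcases lt_or_ge c.length w.length with hcw | hcw
    · obtain ⟨q, rfl⟩ : c <+: w := List.prefix_of_prefix_length_le (l₃ := w ++ X ++ y)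
        (e ▸ ⟨X₀ ++ Y₀ ++ p, by simp⟩) ⟨X ++ y, by simp⟩ hcw.le
      have hq0 : q ≠ [] := by rintro rfl; simp at hcw
      have e' : q ++ X ++ y = X₀ ++ Y₀ ++ p := by simpa using e
      refine hD.not_piece_append hy ⟨z, hz⟩ (Piece.of_occurrences (a₁ := q) (b₁ := p')
        (a₂ := []) (b₂ := z ++ Z) hD₀.1 hD.1 ?_ (by simp [← hz]) (Or.inr hq0))
      rw [← hp', ← List.append_assoc, ← e']
      simp
    · obtain ⟨q, rfl⟩ : w <+: c := List.prefix_of_prefix_length_le (l₃ := w ++ X ++ y)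
        ⟨X ++ y, by simp⟩ (e ▸ ⟨X₀ ++ Y₀ ++ p, by simp⟩) hcw
      have e' : X ++ y = q ++ X₀ ++ Y₀ ++ p := by simpa using e
      by_cases hsame : X₀ ++ Y₀ ++ Z₀ = X ++ Y ++ Z
      · have h₁ := congrArg List.length (hD₀.eq_prefix_middle hD hsame)
        have h₂ := congrArg List.length e'
        simp at h₁ h₂
        omega
      · exact hC.not_piece_prefix_middle hD₀ (Piece.of_occurrences (a₁ := []) (b₁ := Z₀)
          (a₂ := q) (b₂ := p ++ z ++ Z) hD₀.1 hD.1 (by simp)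
          (by rw [← hz, ← List.append_assoc X, e']; simp) (Or.inl hsame))

theorem Inert.chain (hC : WeaklyC R 4) {b : List A} (hb : Inert R b)
    {Xs Ys Zs Ys' : ℕ → List A} (n : ℕ) (hD : ∀ i < n, RelDecomp R (Xs i) (Ys i) (Zs i))
    (hY : ∀ i < n, Ys' i ≠ [] ∧ Ys' i <+: Ys i ∧ Ys' i ≠ Ys i) :
    Inert R (b ++ ((List.range n).map fun i => Xs i ++ Ys' i).flatten) := by
  induction n with
  | zero => simpa using hb
  | succ n ih =>
    have h := (ih (fun i hi => hD i (by omega)) fun i hi => hY i (by omega)).append hC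
      (hD n (by omega)) (hY n (by omega)).1 (hY n (by omega)).2.1 (hY n (by omega)).2.2
    simpa [List.range_succ] using h

/-- `w` extends to an inert prefix of `v` that is followed by `X ++ Y`, the maximal piece prefix
and middle word of a relation word. -/
def InertExtension (R : Finset (List A × List A)) (w v : List A) : Prop :=
  ∃ w' X Y Z s, w <+: w' ∧ Inert R w' ∧ RelDecomp R X Y Z ∧ v = w' ++ X ++ Y ++ s

theorem inertExtension_of_oPrefix (hC : WeaklyC R 4) {u w X Y : List A}
    (h : OPrefix R u w X Y) : InertExtension R w u := by
  obtain ⟨⟨s, hs⟩, b, n, Xs, Ys, Zs, Ys', hn, rfl, rfl, hw, hD, hY, hno⟩ := h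
  have hb : Inert R b := by
    have key : ∀ c X₀ Y₀ Z₀ d, RelDecomp R X₀ Y₀ Z₀ → b ≠ c ++ X₀ ++ Y₀ ++ d := by
      rintro c X₀ Y₀ Z₀ d hD₀ rfl
      refine hno ⟨c, _, X₀, Y₀, Z₀, hD₀, by rw [hw]; simp only [List.append_assoc]; rfl, ?_⟩
      have := List.length_pos_iff.2 (hC.middle_ne_nil hD₀)
      simp only [List.length_append]
      omega
    refine ⟨fun c r d hr e => ?_, fun c X₀ Y₀ Z₀ p hD₀ _ => key c X₀ Y₀ Z₀ p hD₀⟩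
    obtain ⟨X₀, Y₀, Z₀, rfl, hD₀⟩ := hC.exists_relDecomp hr
    exact key c X₀ Y₀ Z₀ (Z₀ ++ d) hD₀ (by simpa using e)
  exact ⟨w, _, _, _, s, List.prefix_rfl,
    hw ▸ hb.chain hC (n - 1) (fun i hi => hD i (by omega)) hY, hD (n - 1) (by omega), hs.symm⟩

theorem InertExtension.replace (hC : WeaklyC R 4) {w l x y t : List A}
    (h : InertExtension R w (l ++ x ++ t)) (hx : RelWord R x) (hy : RelWord R y) :
    InertExtension R w (l ++ y ++ t) := by
  obtain ⟨w', X, Y, Z, s, hww', hw', hD, e⟩ := h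
  obtain ⟨X₁, Y₁, Z₁, rfl, hD₁⟩ := hC.exists_relDecomp hy
  have hle := hw'.length_le hC hD (hC.middle_ne_nil hD) List.prefix_rfl hx e.symm
  obtain ⟨l, rfl⟩ : w' <+: l := List.prefix_of_prefix_length_le (l₃ := w' ++ X ++ Y ++ s)
    ⟨X ++ Y ++ s, by simp⟩ (e ▸ ⟨x ++ t, by simp⟩) hle
  have e' : l ++ (x ++ t) = X ++ Y ++ s := by simpa using e
  rcases eq_or_ne l [] with rfl | hl
  · exact ⟨w', X₁, Y₁, Z₁, Z₁ ++ t, hww', hw', hD₁, by simp⟩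
  rcases List.append_eq_append_iff.1 e' with ⟨m, hm, hxt⟩ | ⟨s', rfl, -⟩
  · rcases eq_or_ne m [] with rfl | hm0
    · exact ⟨w', X, Y, Z, X₁ ++ Y₁ ++ Z₁ ++ t, hww', hw', hD, by simp [hm]⟩
    rcases List.append_eq_append_iff.1 hm with ⟨y', rfl, rfl⟩ | ⟨m', rfl, rfl⟩
    · rcases eq_or_ne y' [] with rfl | hy0
      · exfalso
        rcases List.prefix_or_prefix_of_prefix ⟨t, hxt⟩ ⟨s, rfl⟩ with ⟨z, rfl⟩ | ⟨z, rfl⟩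
        · exact hC.not_piece_relWord hx (Piece.of_occurrences (a₁ := X) (b₁ := z ++ Z)
            (a₂ := []) (b₂ := []) hD.1 hx (by simp) (by simp) (Or.inr (by simpa using hl)))
        · exact hC.not_piece_middle hD (Piece.of_occurrences (a₁ := X) (b₁ := Z)
            (a₂ := []) (b₂ := z) hD.1 hx (by simp) (by simp) (Or.inr (by simpa using hl)))
      · exact ⟨w' ++ X ++ y', X₁, Y₁, Z₁, Z₁ ++ t, hww'.trans ⟨X ++ y', by simp⟩,
          hw'.append hC hD hy0 ⟨m, rfl⟩ (by simpa using hm0), hD₁, by simp⟩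
    · exfalso
      rcases List.prefix_or_prefix_of_prefix ⟨t, hxt⟩ ⟨s, rfl⟩ with ⟨z, hz⟩ | ⟨z, rfl⟩
      · exact hC.not_piece_relWord hx (Piece.of_occurrences (a₁ := l) (b₁ := z ++ Z)
          (a₂ := []) (b₂ := []) hD.1 hx (by
            simp only [List.append_assoc] at hz ⊢
            rw [← List.append_assoc x, hz]; simp) (by simp) (Or.inr hl))
      · exact hC.not_piece_middle hD (Piece.of_factor (a := m') (b := [])
          (Piece.of_occurrences (a₁ := l) (b₁ := Z) (a₂ := []) (b₂ := z) hD.1 hx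
            (by simp) (by simp) (Or.inr hl)))
  · exact ⟨w', X, Y, Z, s' ++ X₁ ++ Y₁ ++ Z₁ ++ t, hww', hw', hD, by simp⟩

theorem OneStep.relWord {u v : List A} (h : OneStep R u v) :
    ∃ l x y t, RelWord R x ∧ RelWord R y ∧ u = l ++ x ++ t ∧ v = l ++ y ++ t := by
  obtain ⟨l, t, x, y, hxy | hxy, hu, hv⟩ := h
  · exact ⟨l, x, y, t, ⟨_, hxy, Or.inl rfl⟩, ⟨_, hxy, Or.inr rfl⟩, hu, hv⟩
  · exact ⟨l, x, y, t, ⟨_, hxy, Or.inr rfl⟩, ⟨_, hxy, Or.inl rfl⟩, hu, hv⟩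

theorem InertExtension.of_mEquiv (hC : WeaklyC R 4) {w u v : List A}
    (h : InertExtension R w u) (huv : MEquiv R u v) : InertExtension R w v := by
  induction huv with
  | refl => exact h
  | tail _ hstep ih =>
    obtain ⟨l, x, y, t, hx, hy, rfl, rfl⟩ := hstep.relWord
    exact ih.replace hC hx hy

end SmallOverlap

/-- Corollary 6: for a weakly `C(4)` finite monoid presentation,
suppose a word `u` has a (not necessarily clean) overlap prefix `w ++ X ++ Y`.  If
`u ≡ v` then `w` is a prefix of `v` and no relation word occurring as a factor of `v`
overlaps the prefix `w`. -/
theorem overlapPrefix_equiv_prefix {A : Type*} [Fintype A] [DecidableEq A]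
    (R : Finset (List A × List A)) (hC : WeaklyC R 4)
    (u w X Y v : List A) (hop : OPrefix R u w X Y) (hequiv : MEquiv R u v) :
    w <+: v ∧ ¬ ∃ s r t, RelWord R r ∧ v = s ++ r ++ t ∧ s.length < w.length := by
  obtain ⟨w', X', Y', Z', s', hww', hw', hD, rfl⟩ :=
    (inertExtension_of_oPrefix hC hop).of_mEquiv hC hequiv
  refine ⟨hww'.trans ⟨X' ++ Y' ++ s', by simp⟩, ?_⟩
  rintro ⟨s, r, t, hr, e, hlt⟩
  have := hw'.length_le hC hD (hC.middle_ne_nil hD) List.prefix_rfl hr e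
  have := hww'.length_le
  omega
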